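/- Let (u_{p_n}) be least energy solutions of the Finsler Lane-Emden problem with p_n → ∞, and set v_n = u_{p_n}/(∫_Ω u_{p_n}^{p_n} dx)^{1/(N-1)}. Then the blow-up set S of the sequence (v_n) is non-empty. -/

import Mathlib

open MeasureTheory Filter Real Set
open scoped RealInnerProductSpace Topology NNReal

noncomputable section

abbrev Euc (N : ℕ) := EuclideanSpace ℝ (Fin N)

/-- `H` is a norm on `ℝ^N`: convex, nonnegative, vanishing exactly at `0`,
and absolutely homogeneous. -/
def IsFinslerNorm (N : ℕ) (H : Euc N → ℝ) : Prop :=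
  ConvexOn ℝ Set.univ H ∧
  (∀ ξ, 0 ≤ H ξ) ∧
  (∀ ξ, H ξ = 0 ↔ ξ = 0) ∧
  (∀ (t : ℝ) (ξ : Euc N), H (t • ξ) = |t| * H ξ)

/-- Regularity assumptions: `H ∈ C²(ℝ^N \ {0})`, `H^N ∈ C¹(ℝ^N)`, and the Hessian of
`H^N` is positive definite away from the origin. -/
def FinslerRegular (N : ℕ) (H : Euc N → ℝ) : Prop :=
  ContDiffOn ℝ 2 H {(0 : Euc N)}ᶜ ∧
  ContDiff ℝ 1 (fun ξ => H ξ ^ N) ∧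
  ∀ ξ : Euc N, ξ ≠ 0 → ∀ v : Euc N, v ≠ 0 →
    0 < iteratedFDeriv ℝ 2 (fun ξ => H ξ ^ N) ξ ![v, v]

/-- The dual norm `H⁰(x) = sup_{ξ ≠ 0} ⟪x, ξ⟫ / H(ξ)`. -/
def dualNorm {N : ℕ} (H : Euc N → ℝ) (x : Euc N) : ℝ :=
  sSup {r : ℝ | ∃ ξ : Euc N, ξ ≠ 0 ∧ r = ⟪x, ξ⟫ / H ξ}

/-- `κ_N`, the volume of the Wulff ball `{H⁰ < 1}`. -/
def wulffVol (N : ℕ) (H : Euc N → ℝ) : ℝ :=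
  (volume {x : Euc N | dualNorm H x < 1}).toReal

/-- `β_N = N (N κ_N)^{1/(N-1)}`. -/
def betaN (N : ℕ) (H : Euc N → ℝ) : ℝ :=
  N * (N * wulffVol N H) ^ ((1 : ℝ) / ((N : ℝ) - 1))

/-- `u` is a weak solution of `-Q_N u = g` on the open set `U`:
`∫_U H(∇u)^{N-1} ⟪∇H(∇u), ∇φ⟫ = ∫_U g φ` for all test functions `φ`. -/
def IsWeakSolution (N : ℕ) (H : Euc N → ℝ) (U : Set (Euc N)) (u g : Euc N → ℝ) : Prop :=
  ∀ φ : Euc N → ℝ, ContDiff ℝ (⊤ : ℕ∞) φ → HasCompactSupport φ → tsupport φ ⊆ U →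
    (∫ x in U, H (gradient u x) ^ (N - 1) * ⟪gradient H (gradient u x), gradient φ x⟫)
      = ∫ x in U, g x * φ x

/-- `C_p`, the infimum of `∫_Ω H(∇u)^N` over test functions normalized in `L^{p+1}`. -/
def energyInf (N : ℕ) (H : Euc N → ℝ) (Ω : Set (Euc N)) (p : ℝ) : ℝ :=
  sInf {c : ℝ | ∃ u : Euc N → ℝ, ContDiff ℝ (⊤ : ℕ∞) u ∧ HasCompactSupport u ∧
    tsupport u ⊆ Ω ∧ (∫ x in Ω, |u x| ^ (p + 1)) = 1 ∧
    c = ∫ x in Ω, H (gradient u x) ^ N}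

/-- A least energy solution of the Finsler Lane–Emden problem on `Ω` with exponent `p`. -/
def IsLeastEnergySolution (N : ℕ) (H : Euc N → ℝ) (Ω : Set (Euc N)) (p : ℝ)
    (u : Euc N → ℝ) : Prop :=
  ContDiffOn ℝ 1 u (closure Ω) ∧
  (∀ x ∈ Ω, 0 < u x) ∧
  (∀ x ∈ frontier Ω, u x = 0) ∧
  IsWeakSolution N H Ω u (fun x => u x ^ p) ∧
  (∫ x in Ω, H (gradient u x) ^ N)
    = energyInf N H Ω p * (∫ x in Ω, u x ^ (p + 1)) ^ ((N : ℝ) / (p + 1))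

/-- The blow-up set of a sequence of functions `v n` on `Ω`. -/
def BlowUpSet {N : ℕ} (Ω : Set (Euc N)) (v : ℕ → Euc N → ℝ) : Set (Euc N) :=
  {x | x ∈ closure Ω ∧ ∃ σ : ℕ → ℕ, StrictMono σ ∧ ∃ xs : ℕ → Euc N,
    (∀ n, xs n ∈ Ω) ∧ Tendsto xs atTop (𝓝 x) ∧
    Tendsto (fun n => v (σ n) (xs n)) atTop atTop}

/-- A compactly supported `C¹` function can be approximated uniformly, together with its gradient,
by smooth functions with compact support in the same open set. -/
lemma exists_contDiff_approx_with_gradient {N : ℕ} {Ω : Set (Euc N)} (hΩ : IsOpen Ω)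
    {φ : Euc N → ℝ} (hφ : ContDiff ℝ 1 φ) (hc : HasCompactSupport φ) (hs : tsupport φ ⊆ Ω)
    {δ : ℝ} (hδ : 0 < δ) :
    ∃ ψ : Euc N → ℝ, ContDiff ℝ (⊤ : ℕ∞) ψ ∧ HasCompactSupport ψ ∧ tsupport ψ ⊆ Ω ∧
      (∀ x, |ψ x - φ x| ≤ δ) ∧ ∀ x, ‖gradient ψ x - gradient φ x‖ ≤ δ := by
  obtain ⟨r₃, hr₃, hr₃Ω⟩ := hc.isCompact.exists_cthickening_subset_open hΩ hs
  have hu₁ := hc.uniformContinuous_of_continuous hφ.continuous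
  have hu₂ := (hc.fderiv ℝ).uniformContinuous_of_continuous (hφ.continuous_fderiv one_ne_zero)
  obtain ⟨r₁, hr₁, h₁⟩ := Metric.uniformContinuous_iff.1 hu₁ δ hδ
  obtain ⟨r₂, hr₂, h₂⟩ := Metric.uniformContinuous_iff.1 hu₂ δ hδ
  set r := min r₁ (min r₂ r₃) with hr
  have hr0 : 0 < r := by positivity
  let b : ContDiffBump (0 : Euc N) := ⟨r / 2, r, by positivity, by linarith⟩
  have hloc : LocallyIntegrable (b.normed volume) (volume : Measure (Euc N)) :=
    (b.continuous_normed).locallyIntegrable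
  set ψ : Euc N → ℝ :=
    convolution (b.normed volume) φ (ContinuousLinearMap.lsmul ℝ ℝ) volume with hψ
  have hsupp : tsupport ψ ⊆ Metric.cthickening r (tsupport φ) := by
    apply closure_minimal _ Metric.isClosed_cthickening
    intro x hx
    obtain ⟨y, hy, z, hz, rfl⟩ := support_convolution_subset (L := ContinuousLinearMap.lsmul ℝ ℝ) hx
    rw [b.support_normed_eq] at hy
    refine Metric.mem_cthickening_of_dist_le _ z _ _ (subset_tsupport _ hz) ?_
    simpa [dist_eq_norm] using (mem_ball_zero_iff.1 hy).le
  have hsuppΩ : tsupport ψ ⊆ Ω := hsupp.trans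
    ((Metric.cthickening_mono ((min_le_right _ _).trans (min_le_right _ _)) _).trans hr₃Ω)
  refine ⟨ψ, b.hasCompactSupport_normed.contDiff_convolution_left _ b.contDiff_normed
    hφ.continuous.locallyIntegrable, b.hasCompactSupport_normed.convolution _ hc, hsuppΩ, ?_, ?_⟩
  · intro x
    rw [← Real.dist_eq]
    refine ContDiffBump.dist_normed_convolution_le hφ.continuous.aestronglyMeasurable ?_
    intro y hy
    exact (h₁ (lt_of_lt_of_le (Metric.mem_ball.1 hy) (min_le_left _ _))).le
  · intro x
    have hd := hc.hasFDerivAt_convolution_right (ContinuousLinearMap.lsmul ℝ ℝ) hloc hφ x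
    have hL : (ContinuousLinearMap.lsmul ℝ ℝ : ℝ →L[ℝ] ℝ →L[ℝ] ℝ).precompR (Euc N) =
        ContinuousLinearMap.lsmul ℝ ℝ := by
      ext; simp
    rw [hL] at hd
    rw [gradient, gradient, ← map_sub, LinearIsometryEquiv.norm_map, hd.fderiv, ← dist_eq_norm]
    refine ContDiffBump.dist_normed_convolution_le
      (hφ.continuous_fderiv one_ne_zero).aestronglyMeasurable ?_
    intro y hy
    exact (h₂ (lt_of_lt_of_le (Metric.mem_ball.1 hy)
      ((min_le_right _ _).trans (min_le_left _ _)))).le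

/-- A `C¹` function on the closure of a bounded open set has bounded gradient. -/
lemma exists_norm_gradient_le {N : ℕ} {Ω : Set (Euc N)} (hΩ : IsOpen Ω)
    (hb : Bornology.IsBounded Ω) {u : Euc N → ℝ} (hu : ContDiffOn ℝ 1 u (closure Ω)) :
    ∃ B : ℝ, 0 ≤ B ∧ ∀ x ∈ Ω, ‖gradient u x‖ ≤ B := by
  have key : ∃ B : ℝ, ∀ x ∈ closure Ω ∩ Ω, ‖gradient u x‖ ≤ B := by
    refine hb.isCompact_closure.induction_on
      (p := fun s => ∃ B : ℝ, ∀ x ∈ s ∩ Ω, ‖gradient u x‖ ≤ B) ⟨0, by simp⟩ ?_ ?_ ?_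
    · rintro s t hst ⟨B, hB⟩
      exact ⟨B, fun x hx => hB x ⟨hst hx.1, hx.2⟩⟩
    · rintro s t ⟨B, hB⟩ ⟨C, hC⟩
      refine ⟨max B C, ?_⟩
      rintro x ⟨hx | hx, hxΩ⟩
      · exact (hB x ⟨hx, hxΩ⟩).trans (le_max_left _ _)
      · exact (hC x ⟨hx, hxΩ⟩).trans (le_max_right _ _)
    · intro x hx
      have h1 : ContDiffWithinAt ℝ (0 + 1) u (closure Ω) x := by simpa using hu x hx
      obtain ⟨s, hs, -, f', hf', hc⟩ :=
        (contDiffWithinAt_succ_iff_hasFDerivWithinAt (by simp)).1 h1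
      rw [insert_eq_of_mem hx] at hs
      have hxs : x ∈ s := mem_of_mem_nhdsWithin hx hs
      have hlim : ∀ᶠ y in 𝓝[s] x, ‖f' y‖ < ‖f' x‖ + 1 :=
        hc.continuousWithinAt.norm.eventually (Iio_mem_nhds (by linarith))
      have hle : 𝓝[closure Ω] x ≤ 𝓝[s] x := by
        rw [nhdsWithin, nhdsWithin]
        exact le_inf inf_le_left (le_principal_iff.2 hs)
      have hev : ∀ᶠ y in 𝓝[closure Ω] x, ‖f' y‖ < ‖f' x‖ + 1 := hle hlim
      obtain ⟨V, hVo, hxV, hV⟩ := mem_nhdsWithin.1 hs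
      refine ⟨{y | ‖f' y‖ < ‖f' x‖ + 1} ∩ (V ∩ closure Ω), inter_mem hev
        (inter_mem (mem_nhdsWithin_of_mem_nhds (hVo.mem_nhds hxV)) self_mem_nhdsWithin),
        ‖f' x‖ + 1, ?_⟩
      rintro y ⟨⟨hy, hyV, -⟩, hyΩ⟩
      have hys : s ∈ 𝓝 y := mem_of_superset ((hVo.inter hΩ).mem_nhds ⟨hyV, hyΩ⟩)
        (fun z hz => hV ⟨hz.1, subset_closure hz.2⟩)
      have := (hf' y (mem_of_mem_nhds hys)).hasFDerivAt hys
      rw [gradient, LinearIsometryEquiv.norm_map, this.fderiv]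
      exact le_of_lt hy
  obtain ⟨B, hB⟩ := key
  exact ⟨max B 0, le_max_right _ _,
    fun x hx => (hB x ⟨subset_closure hx, hx⟩).trans (le_max_left _ _)⟩

/-- An integrated-by-parts identity valid for smooth test functions extends to `C¹` ones. -/
lemma integral_inner_gradient_eq_of_forall_smooth {N : ℕ} {Ω : Set (Euc N)} (hΩ : IsOpen Ω)
    {J : Euc N → Euc N} {g : Euc N → ℝ} (hJ : IntegrableOn J Ω) (hg : IntegrableOn g Ω)
    (hw : ∀ φ : Euc N → ℝ, ContDiff ℝ (⊤ : ℕ∞) φ → HasCompactSupport φ → tsupport φ ⊆ Ω →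
      ∫ x in Ω, ⟪J x, gradient φ x⟫ = ∫ x in Ω, g x * φ x)
    {φ : Euc N → ℝ} (hφ : ContDiff ℝ 1 φ) (hc : HasCompactSupport φ) (hs : tsupport φ ⊆ Ω) :
    ∫ x in Ω, ⟪J x, gradient φ x⟫ = ∫ x in Ω, g x * φ x := by
  have hintJ : ∀ ψ : Euc N → ℝ, ContDiff ℝ 1 ψ → HasCompactSupport ψ →
      IntegrableOn (fun x => ⟪J x, gradient ψ x⟫) Ω := by
    intro ψ hψ hψc
    have hcont : Continuous (gradient ψ) :=
      (LinearIsometryEquiv.continuous _).comp (hψ.continuous_fderiv one_ne_zero)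
    obtain ⟨C, hC⟩ := (hψc.fderiv ℝ).exists_bound_of_continuous
      (hψ.continuous_fderiv one_ne_zero)
    refine (hJ.norm.mul_const C).mono' (hJ.aestronglyMeasurable.inner
      hcont.aestronglyMeasurable) (Eventually.of_forall fun x => ?_)
    refine (norm_inner_le_norm _ _).trans ?_
    gcongr
    rw [gradient, LinearIsometryEquiv.norm_map]
    exact hC x
  have hintg : ∀ ψ : Euc N → ℝ, ContDiff ℝ 1 ψ → HasCompactSupport ψ →
      IntegrableOn (fun x => g x * ψ x) Ω := by
    intro ψ hψ hψc
    obtain ⟨C, hC⟩ := hψc.exists_bound_of_continuous hψ.continuous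
    refine (hg.norm.mul_const C).mono' (hg.aestronglyMeasurable.mul
      hψ.continuous.aestronglyMeasurable) (Eventually.of_forall fun x => ?_)
    rw [norm_mul]
    gcongr
    exact hC x
  set A := (∫ x in Ω, ‖J x‖) + ∫ x in Ω, ‖g x‖ with hA
  have hA0 : 0 ≤ A := by positivity
  have key : ∀ δ > 0, |(∫ x in Ω, ⟪J x, gradient φ x⟫) - ∫ x in Ω, g x * φ x| ≤ A * δ := by
    intro δ hδ
    obtain ⟨ψ, hψ, hψc, hψs, h0, h1⟩ := exists_contDiff_approx_with_gradient hΩ hφ hc hs hδ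
    have hψ1 : ContDiff ℝ 1 ψ := hψ.of_le (by exact_mod_cast le_top)
    have e1 : |(∫ x in Ω, ⟪J x, gradient φ x⟫) - ∫ x in Ω, ⟪J x, gradient ψ x⟫|
        ≤ (∫ x in Ω, ‖J x‖) * δ := by
      rw [← integral_sub (hintJ φ hφ hc) (hintJ ψ hψ1 hψc), ← integral_mul_const,
        ← Real.norm_eq_abs]
      refine norm_integral_le_of_norm_le (hJ.norm.mul_const δ) (Eventually.of_forall fun x => ?_)
      rw [← inner_sub_right]
      refine (norm_inner_le_norm _ _).trans ?_
      gcongr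
      rw [norm_sub_rev]
      exact h1 x
    have e2 : |(∫ x in Ω, g x * ψ x) - ∫ x in Ω, g x * φ x| ≤ (∫ x in Ω, ‖g x‖) * δ := by
      rw [← integral_sub (hintg ψ hψ1 hψc) (hintg φ hφ hc), ← integral_mul_const,
        ← Real.norm_eq_abs]
      refine norm_integral_le_of_norm_le (hg.norm.mul_const δ) (Eventually.of_forall fun x => ?_)
      rw [← mul_sub, norm_mul]
      gcongr
      exact h0 x
    rw [hw ψ hψ hψc hψs] at e1
    calc _ ≤ _ := abs_sub_le _ (∫ x in Ω, g x * ψ x) _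
      _ ≤ A * δ := by rw [hA, add_mul]; exact add_le_add e1 e2
  by_contra hne
  have hd := abs_pos.2 (sub_ne_zero.2 hne)
  set d := |(∫ x in Ω, ⟪J x, gradient φ x⟫) - ∫ x in Ω, g x * φ x| with hd'
  have h2 := key (d / (2 * (A + 1))) (by positivity)
  have h3 : A * (d / (2 * (A + 1))) ≤ d / 2 := by
    rw [mul_div_assoc', div_le_div_iff₀ (by positivity) (by positivity)]
    nlinarith
  linarith

namespace IsFinslerNorm

variable {N : ℕ} {H : Euc N → ℝ}

lemma nonneg (h : IsFinslerNorm N H) (ξ : Euc N) : 0 ≤ H ξ := h.2.1 ξ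

lemma map_zero (h : IsFinslerNorm N H) : H 0 = 0 := (h.2.2.1 0).2 rfl

lemma map_smul (h : IsFinslerNorm N H) (t : ℝ) (ξ : Euc N) : H (t • ξ) = |t| * H ξ := h.2.2.2 t ξ

lemma add_le (h : IsFinslerNorm N H) (x y : Euc N) : H (x + y) ≤ H x + H y := by
  have h1 := h.1.2 (mem_univ x) (mem_univ y) (by norm_num : (0 : ℝ) ≤ 1 / 2)
    (by norm_num : (0 : ℝ) ≤ 1 / 2) (by norm_num)
  rw [← smul_add, h.map_smul, abs_of_pos (by norm_num : (0 : ℝ) < 1 / 2)] at h1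
  simp only [smul_eq_mul] at h1
  linarith

lemma exists_le_mul_norm (h : IsFinslerNorm N H) : ∃ C : ℝ≥0, ∀ ξ, H ξ ≤ C * ‖ξ‖ := by
  have hcont : Continuous H := h.1.locallyLipschitz.continuous
  obtain ⟨C, hC⟩ := (isCompact_closedBall (0 : Euc N) 1).exists_bound_of_continuousOn
    hcont.continuousOn
  refine ⟨C.toNNReal, fun ξ => ?_⟩
  rcases eq_or_ne ξ 0 with rfl | hξ
  · simp [h.map_zero]
  · have hpos : 0 < ‖ξ‖ := norm_pos_iff.2 hξ
    have h1 := (Real.le_norm_self _).trans (hC (‖ξ‖⁻¹ • ξ) (by simp [norm_smul, hpos.ne']))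
    rw [h.map_smul, abs_of_pos (by positivity), inv_mul_le_iff₀ hpos, mul_comm] at h1
    exact h1.trans (by gcongr; exact Real.le_coe_toNNReal C)

lemma exists_lipschitzWith (h : IsFinslerNorm N H) :
    ∃ C : ℝ≥0, LipschitzWith C H ∧ ∀ ξ, H ξ ≤ C * ‖ξ‖ := by
  obtain ⟨C, hC⟩ := h.exists_le_mul_norm
  refine ⟨C, LipschitzWith.of_le_add_mul C fun x y => ?_, hC⟩
  have := h.add_le y (x - y)
  rw [add_sub_cancel] at this
  rw [dist_eq_norm]
  exact this.trans (by gcongr; exact hC _)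

/-- Euler's identity for the `1`-homogeneous function `H`. -/
lemma inner_gradient_self (h : IsFinslerNorm N H) {ξ : Euc N} (hd : DifferentiableAt ℝ H ξ) :
    ⟪gradient H ξ, ξ⟫ = H ξ := by
  have h1 : HasDerivAt (fun t : ℝ => H (t • ξ)) (fderiv ℝ H ξ ξ) 1 := by
    have hf : HasFDerivAt H (fderiv ℝ H ξ) ((1 : ℝ) • ξ) := by simpa using hd.hasFDerivAt
    have hg : HasDerivAt (fun t : ℝ => t • ξ) ((1 : ℝ) • ξ) 1 := (hasDerivAt_id 1).smul_const ξ
    have hfg := hf.comp_hasDerivAt 1 hg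
    rw [one_smul] at hfg
    exact hfg
  have h2 : HasDerivAt (fun t : ℝ => H (t • ξ)) (H ξ) 1 := by
    have : HasDerivAt (fun t : ℝ => t * H ξ) (1 * H ξ) 1 := (hasDerivAt_id 1).mul_const (H ξ)
    rw [one_mul] at this
    refine this.congr_of_eventuallyEq ?_
    filter_upwards [lt_mem_nhds (zero_lt_one' ℝ)] with t ht
    rw [h.map_smul, abs_of_pos ht]
  rw [inner_gradient_left]
  exact h1.unique h2

lemma pow_mul_inner_gradient_self (h : IsFinslerNorm N H) (hreg : FinslerRegular N H)
    (hN : 2 ≤ N) (ξ : Euc N) : H ξ ^ (N - 1) * ⟪gradient H ξ, ξ⟫ = H ξ ^ N := by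
  rcases eq_or_ne ξ 0 with rfl | hξ
  · rw [h.map_zero, zero_pow (by lia), zero_pow (by lia), zero_mul]
  · have hd : DifferentiableAt ℝ H ξ :=
      (hreg.1.differentiableOn two_ne_zero).differentiableAt
        (isOpen_compl_singleton.mem_nhds hξ)
    rw [h.inner_gradient_self hd, ← pow_succ, Nat.sub_add_cancel (by lia)]

end IsFinslerNorm

lemma measurable_gradient {N : ℕ} (f : Euc N → ℝ) : Measurable (gradient f) :=
  (LinearIsometryEquiv.continuous _).measurable.comp (measurable_fderiv ℝ f)

/-- A `C¹` truncation of the identity, vanishing below `ε`. -/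
lemma exists_contDiff_truncation {ε : ℝ} (hε : 0 < ε) :
    ∃ g : ℝ → ℝ, ContDiff ℝ 1 g ∧ (∀ t ≤ ε, g t = 0) ∧
      (∀ t, 0 ≤ deriv g t ∧ deriv g t ≤ 1) ∧ ∀ t, t - 2 * ε ≤ g t := by
  set S : ℝ → ℝ := fun s => max 0 (min 1 (s / ε - 1)) with hS
  have hSc : Continuous S := by fun_prop
  have hS0 : ∀ s, 0 ≤ S s := fun s => le_max_left _ _
  have hS1 : ∀ s, S s ≤ 1 := fun s => max_le zero_le_one (min_le_left _ _)
  have hlow : ∀ s ≤ ε, S s = 0 := by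
    intro s hs
    have : s / ε ≤ 1 := (div_le_one hε).2 hs
    exact max_eq_left ((min_le_right _ _).trans (by linarith))
  have hhigh : ∀ s, 2 * ε ≤ s → S s = 1 := by
    intro s hs
    have : 2 ≤ s / ε := (le_div_iff₀ hε).2 hs
    simp only [hS]
    rw [min_eq_left (by linarith), max_eq_right zero_le_one]
  have hder : ∀ t, HasDerivAt (fun t => ∫ s in ε..t, S s) (S t) t := fun t =>
    intervalIntegral.integral_hasDerivAt_right (hSc.intervalIntegrable _ _)
      (hSc.stronglyMeasurableAtFilter _ _) hSc.continuousAt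
  have hderiv : deriv (fun t => ∫ s in ε..t, S s) = S := funext fun t => (hder t).deriv
  have hzero : ∀ t ≤ ε, ∫ s in ε..t, S s = 0 := by
    intro t ht
    rw [intervalIntegral.integral_congr (g := fun _ => (0 : ℝ))]
    · simp
    · intro s hs
      rw [uIcc_of_ge ht] at hs
      exact hlow s hs.2
  refine ⟨fun t => ∫ s in ε..t, S s, ?_, hzero, ?_, ?_⟩
  · rw [contDiff_one_iff_deriv, hderiv]
    exact ⟨fun t => (hder t).differentiableAt, hSc⟩
  · intro t
    rw [hderiv]
    exact ⟨hS0 t, hS1 t⟩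
  · intro t
    change t - 2 * ε ≤ ∫ s in ε..t, S s
    rcases le_total t (2 * ε) with ht | ht
    · rcases le_total t ε with h | h
      · rw [hzero t h]; linarith
      · have := intervalIntegral.integral_nonneg (μ := volume) h (fun s _ => hS0 s)
        linarith
    · rw [← intervalIntegral.integral_add_adjacent_intervals (hSc.intervalIntegrable ε (2 * ε))
        (hSc.intervalIntegrable _ t)]
      have h1 := intervalIntegral.integral_nonneg (μ := volume) (a := ε) (b := 2 * ε)
        (by linarith) (fun s _ => hS0 s)
      rw [intervalIntegral.integral_congr (a := 2 * ε) (b := t) (g := fun _ => (1 : ℝ))]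
      · simp only [intervalIntegral.integral_const, smul_eq_mul, mul_one]
        linarith
      · intro s hs
        rw [uIcc_of_le ht] at hs
        exact hhigh s hs.1

lemma integrableOn_of_continuousOn_closure {N : ℕ} {Ω : Set (Euc N)}
    (hb : Bornology.IsBounded Ω) {f : Euc N → ℝ} (hf : ContinuousOn f (closure Ω)) :
    IntegrableOn f Ω :=
  (hf.integrableOn_compact hb.isCompact_closure).mono_set subset_closure

/-- Composition with a truncation turns a function vanishing on the boundary into an admissible
`C¹` test function. -/
lemma contDiff_indicator_truncation {N : ℕ} {Ω : Set (Euc N)} (hΩ : IsOpen Ω)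
    (hb : Bornology.IsBounded Ω) {u : Euc N → ℝ} (hu : ContDiffOn ℝ 1 u (closure Ω))
    (hfr : ∀ x ∈ frontier Ω, u x = 0) {g : ℝ → ℝ} (hg : ContDiff ℝ 1 g) {ε : ℝ} (hε : 0 < ε)
    (hg0 : ∀ t ≤ ε, g t = 0) :
    ContDiff ℝ 1 (Ω.indicator fun x => g (u x)) ∧
      HasCompactSupport (Ω.indicator fun x => g (u x)) ∧
      tsupport (Ω.indicator fun x => g (u x)) ⊆ Ω := by
  set K : Set (Euc N) := closure Ω ∩ u ⁻¹' Ici ε with hK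
  have hKclosed : IsClosed K := hu.continuousOn.preimage_isClosed_of_isClosed isClosed_closure
    isClosed_Ici
  have hKcomp : IsCompact K := hb.isCompact_closure.of_isClosed_subset hKclosed inter_subset_left
  have hKΩ : K ⊆ Ω := by
    rintro x ⟨hx, hxu⟩
    by_contra hxΩ
    have := hfr x ⟨hx, by rwa [hΩ.interior_eq]⟩
    rw [mem_preimage, this, mem_Ici] at hxu
    linarith
  have hout : ∀ x ∉ K, Ω.indicator (fun x => g (u x)) x = 0 := by
    intro x hx
    by_cases hxΩ : x ∈ Ω
    · rw [indicator_of_mem hxΩ]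
      refine hg0 _ (le_of_not_ge fun h => hx ⟨subset_closure hxΩ, h⟩)
    · exact indicator_of_notMem hxΩ _
  have hts : tsupport (Ω.indicator fun x => g (u x)) ⊆ K :=
    closure_minimal (fun x hx => by_contra fun h => hx (hout x h)) hKclosed
  refine ⟨contDiff_iff_contDiffAt.2 fun x => ?_, HasCompactSupport.intro hKcomp hout,
    hts.trans hKΩ⟩
  by_cases hx : x ∈ Ω
  · have h1 : ContDiffAt ℝ 1 u x :=
      (hu x (subset_closure hx)).contDiffAt (mem_of_superset (hΩ.mem_nhds hx) subset_closure)
    refine (hg.contDiffAt.comp x h1).congr_of_eventuallyEq ?_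
    filter_upwards [hΩ.mem_nhds hx] with y hy
    rw [indicator_of_mem hy, Function.comp_apply]
  · refine (contDiffAt_const (c := (0 : ℝ))).congr_of_eventuallyEq ?_
    filter_upwards [hKclosed.isOpen_compl.mem_nhds (fun h => hx (hKΩ h))] with y hy
    exact hout y hy

/-- Testing the equation with (truncations of) the solution itself. -/
lemma integral_rpow_add_one_le_energy {N : ℕ} (hN : 2 ≤ N) {H : Euc N → ℝ}
    (hnorm : IsFinslerNorm N H) (hreg : FinslerRegular N H)
    {Ω : Set (Euc N)} (hΩ : IsOpen Ω) (hb : Bornology.IsBounded Ω) {p : ℝ} (hp : 0 < p)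
    {u : Euc N → ℝ} (hu : ContDiffOn ℝ 1 u (closure Ω)) (hpos : ∀ x ∈ Ω, 0 < u x)
    (hfr : ∀ x ∈ frontier Ω, u x = 0) (hw : IsWeakSolution N H Ω u (fun x => u x ^ p)) :
    ∫ x in Ω, u x ^ (p + 1) ≤ ∫ x in Ω, H (gradient u x) ^ N := by
  obtain ⟨C, hLip, hC⟩ := hnorm.exists_lipschitzWith
  obtain ⟨B, hB0, hB⟩ := exists_norm_gradient_le hΩ hb hu
  have hHm : Measurable H := hLip.continuous.measurable
  have hgm := measurable_gradient u
  have hHB : ∀ x ∈ Ω, H (gradient u x) ≤ C * B := fun x hx =>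
    (hC _).trans (by gcongr; exact hB x hx)
  have hE : IntegrableOn (fun x => H (gradient u x) ^ N) Ω := by
    refine IntegrableOn.of_bound (C := (C * B) ^ N) hb.measure_lt_top
      ((hHm.comp hgm).pow_const N).aestronglyMeasurable ?_
    filter_upwards [ae_restrict_mem hΩ.measurableSet] with x hx
    rw [Real.norm_of_nonneg (pow_nonneg (hnorm.nonneg _) _)]
    exact pow_le_pow_left₀ (hnorm.nonneg _) (hHB x hx) _
  set J : Euc N → Euc N := fun x => H (gradient u x) ^ (N - 1) • gradient H (gradient u x)
  have hJ : IntegrableOn J Ω := by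
    refine IntegrableOn.of_bound (C := (C * B) ^ (N - 1) * C) hb.measure_lt_top
      (((hHm.comp hgm).pow_const _).smul
        ((measurable_gradient H).comp hgm)).aestronglyMeasurable ?_
    filter_upwards [ae_restrict_mem hΩ.measurableSet] with x hx
    rw [norm_smul, Real.norm_of_nonneg (pow_nonneg (hnorm.nonneg _) _)]
    have h2 : ‖gradient H (gradient u x)‖ ≤ C := by
      rw [gradient, LinearIsometryEquiv.norm_map]
      exact norm_fderiv_le_of_lipschitz ℝ hLip
    have h1 := pow_le_pow_left₀ (hnorm.nonneg _) (hHB x hx) (N - 1)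
    gcongr
  have hup : IntegrableOn (fun x => u x ^ p) Ω :=
    integrableOn_of_continuousOn_closure hb
      (hu.continuousOn.rpow_const fun x _ => Or.inr hp.le)
  have hup1 : IntegrableOn (fun x => u x ^ (p + 1)) Ω :=
    integrableOn_of_continuousOn_closure hb
      (hu.continuousOn.rpow_const fun x _ => Or.inr (by linarith))
  have hweak : ∀ φ : Euc N → ℝ, ContDiff ℝ (⊤ : ℕ∞) φ → HasCompactSupport φ → tsupport φ ⊆ Ω →
      ∫ x in Ω, ⟪J x, gradient φ x⟫ = ∫ x in Ω, u x ^ p * φ x := by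
    intro φ h1 h2 h3
    rw [← hw φ h1 h2 h3]
    simp only [J, real_inner_smul_left]
  have key : ∀ ε > 0, (∫ x in Ω, u x ^ (p + 1)) - 2 * ε * ∫ x in Ω, u x ^ p
      ≤ ∫ x in Ω, H (gradient u x) ^ N := by
    intro ε hε
    obtain ⟨g, hg, hg0, hg', hgle⟩ := exists_contDiff_truncation hε
    obtain ⟨hφ, hφc, hφs⟩ := contDiff_indicator_truncation hΩ hb hu hfr hg hε hg0
    have hid := integral_inner_gradient_eq_of_forall_smooth hΩ hJ hup hweak hφ hφc hφs
    have hgrad : ∀ x ∈ Ω, ⟪J x, gradient (Ω.indicator fun x => g (u x)) x⟫ =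
        deriv g (u x) * H (gradient u x) ^ N := by
      intro x hx
      have hux : DifferentiableAt ℝ u x :=
        ((hu x (subset_closure hx)).contDiffAt
          (mem_of_superset (hΩ.mem_nhds hx) subset_closure)).differentiableAt one_ne_zero
      have hgx : HasDerivAt g (deriv g (u x)) (u x) :=
        (hg.differentiable one_ne_zero (u x)).hasDerivAt
      have hcomp := hgx.comp_hasFDerivAt x hux.hasFDerivAt
      have heq : (Ω.indicator fun x => g (u x)) =ᶠ[𝓝 x] g ∘ u := by
        filter_upwards [hΩ.mem_nhds hx] with y hy
        rw [indicator_of_mem hy, Function.comp_apply]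
      have hgr : gradient (Ω.indicator fun x => g (u x)) x = deriv g (u x) • gradient u x := by
        rw [gradient, heq.fderiv_eq, hcomp.fderiv, map_smul, gradient]
      rw [hgr, real_inner_smul_left, real_inner_smul_right,
        ← hnorm.pow_mul_inner_gradient_self hreg hN]
      ring
    rw [setIntegral_congr_fun hΩ.measurableSet hgrad] at hid
    have hle : ∫ x in Ω, deriv g (u x) * H (gradient u x) ^ N
        ≤ ∫ x in Ω, H (gradient u x) ^ N := by
      refine integral_mono_of_nonneg (Eventually.of_forall fun x =>
        mul_nonneg (hg' _).1 (pow_nonneg (hnorm.nonneg _) _)) hE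
        (Eventually.of_forall fun x => ?_)
      exact mul_le_of_le_one_left (pow_nonneg (hnorm.nonneg _) _) (hg' _).2
    refine le_trans ?_ (hid.symm.le.trans hle)
    rw [← integral_const_mul, ← integral_sub hup1 (hup.const_mul _)]
    obtain ⟨D, hD⟩ := hφc.exists_bound_of_continuous hφ.continuous
    refine setIntegral_mono_on (hup1.sub (hup.const_mul _)) ?_ hΩ.measurableSet fun x hx => ?_
    · exact hup.mul_bdd hφ.continuous.aestronglyMeasurable (Eventually.of_forall hD)
    · have h1 := hpos x hx
      rw [indicator_of_mem hx, Real.rpow_add_one h1.ne']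
      have := mul_le_mul_of_nonneg_left (hgle (u x)) (Real.rpow_nonneg h1.le p)
      linarith
  refine le_of_tendsto (f := fun ε : ℝ => (∫ x in Ω, u x ^ (p + 1)) - 2 * ε * ∫ x in Ω, u x ^ p)
    (x := 𝓝[>] 0) ?_ (eventually_nhdsWithin_of_forall key)
  refine Tendsto.mono_left ?_ nhdsWithin_le_nhds
  refine Continuous.tendsto' (by fun_prop) _ _ (by simp)

/-- Scale-invariant bound for the `N`-energy of rescaled cutoff functions. -/
lemma exists_cutoff_energy_le {N : ℕ} (hN : N ≠ 0) {H : Euc N → ℝ} (hnorm : IsFinslerNorm N H) :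
    ∃ D : ℝ, 0 ≤ D ∧ ∀ (x₀ : Euc N) (s : ℝ), 0 < s → ∃ η : Euc N → ℝ,
      ContDiff ℝ (⊤ : ℕ∞) η ∧ tsupport η ⊆ Metric.closedBall x₀ s ∧
      (∀ x ∈ Metric.ball x₀ (s / 2), η x = 1) ∧ ∫ x, H (gradient η x) ^ N ≤ D := by
  obtain ⟨C, hC⟩ := hnorm.exists_le_mul_norm
  let b : ContDiffBump (0 : Euc N) := ⟨1 / 2, 1, by norm_num, by norm_num⟩
  have hbsm : ContDiff ℝ 1 b := b.contDiff
  obtain ⟨M, hM⟩ := (b.hasCompactSupport.fderiv ℝ).exists_bound_of_continuous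
    (hbsm.continuous_fderiv one_ne_zero)
  have hM0 : 0 ≤ M := (norm_nonneg _).trans (hM 0)
  refine ⟨(C * M) ^ N * volume.real (Metric.ball (0 : Euc N) 1), by positivity,
    fun x₀ s hs => ?_⟩
  have hsupp : tsupport (fun x => b (s⁻¹ • (x - x₀))) ⊆ Metric.closedBall x₀ s := by
    refine closure_minimal (fun x hx => ?_) Metric.isClosed_closedBall
    have h1 : s⁻¹ • (x - x₀) ∈ Function.support b := hx
    rw [b.support_eq, mem_ball_zero_iff, norm_smul, norm_inv, Real.norm_of_nonneg hs.le,
      inv_mul_lt_iff₀ hs] at h1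
    rw [mem_closedBall_iff_norm]
    simpa [b] using h1.le
  refine ⟨fun x => b (s⁻¹ • (x - x₀)), ?_, hsupp, ?_, ?_⟩
  · exact b.contDiff.comp (by fun_prop)
  · intro x hx
    refine b.one_of_mem_closedBall ?_
    rw [mem_closedBall_zero_iff, norm_smul, norm_inv, Real.norm_of_nonneg hs.le,
      inv_mul_le_iff₀ hs]
    rw [mem_ball_iff_norm] at hx
    change ‖x - x₀‖ ≤ s * (1 / 2)
    linarith
  · have hgr : ∀ x, ‖gradient (fun x => b (s⁻¹ • (x - x₀))) x‖ ≤ M * s⁻¹ := by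
      intro x
      have h1 : HasFDerivAt (fun x : Euc N => s⁻¹ • (x - x₀))
          (s⁻¹ • ContinuousLinearMap.id ℝ (Euc N)) x :=
        ((hasFDerivAt_id x).sub_const x₀).const_smul s⁻¹
      have h2 := ((hbsm.differentiable one_ne_zero _).hasFDerivAt).comp x h1
      rw [gradient, LinearIsometryEquiv.norm_map]
      change ‖fderiv ℝ (b ∘ fun x => s⁻¹ • (x - x₀)) x‖ ≤ _
      rw [h2.fderiv]
      refine (ContinuousLinearMap.opNorm_comp_le _ _).trans ?_
      gcongr
      · exact hM _
      · rw [norm_smul, norm_inv, Real.norm_of_nonneg hs.le]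
        exact mul_le_of_le_one_right (by positivity) ContinuousLinearMap.norm_id_le
    have hzero : ∀ x ∉ Metric.closedBall x₀ s,
        gradient (fun x => b (s⁻¹ • (x - x₀))) x = 0 := by
      intro x hx
      rw [gradient, image_eq_zero_of_notMem_tsupport
        (f := fderiv ℝ (fun x => b (s⁻¹ • (x - x₀))))
        (fun h => hx (hsupp (tsupport_fderiv_subset ℝ h))), _root_.map_zero]
    calc ∫ x, H (gradient (fun x => b (s⁻¹ • (x - x₀))) x) ^ N
        ≤ ∫ x, (Metric.closedBall x₀ s).indicator (fun _ => (C * (M * s⁻¹)) ^ N) x := by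
          refine integral_mono_of_nonneg
            (Eventually.of_forall fun x => pow_nonneg (hnorm.nonneg _) _)
            ((integrable_indicator_iff Metric.isClosed_closedBall.measurableSet).2
              (integrableOn_const measure_closedBall_lt_top.ne))
            (Eventually.of_forall fun x => ?_)
          by_cases hx : x ∈ Metric.closedBall x₀ s
          · simp only [indicator_of_mem hx]
            exact pow_le_pow_left₀ (hnorm.nonneg _) ((hC _).trans (by gcongr; exact hgr x)) _
          · simp only [indicator_of_notMem hx, hzero x hx, hnorm.map_zero]
            rw [zero_pow hN]
      _ = (C * M) ^ N * volume.real (Metric.ball (0 : Euc N) 1) := by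
          rw [integral_indicator Metric.isClosed_closedBall.measurableSet, setIntegral_const,
            Measure.real, Measure.addHaar_closedBall _ _ hs.le, finrank_euclideanSpace_fin,
            ENNReal.toReal_mul, ENNReal.toReal_ofReal (by positivity), smul_eq_mul, Measure.real, ← mul_assoc, ← div_eq_mul_inv,
            div_pow]
          field_simp

lemma gradient_add {N : ℕ} {f g : Euc N → ℝ} {x : Euc N} (hf : DifferentiableAt ℝ f x)
    (hg : DifferentiableAt ℝ g x) : gradient (f + g) x = gradient f x + gradient g x := by
  rw [gradient, fderiv_add hf hg, map_add, gradient, gradient]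

lemma gradient_const_smul {N : ℕ} {f : Euc N → ℝ} {x : Euc N} (hf : DifferentiableAt ℝ f x)
    (c : ℝ) : gradient (c • f) x = c • gradient f x := by
  rw [gradient, fderiv_const_smul hf, map_smul, gradient]

lemma integrable_energy {N : ℕ} (hN : N ≠ 0) {H : Euc N → ℝ} (hnorm : IsFinslerNorm N H)
    {f : Euc N → ℝ} (hf : ContDiff ℝ 1 f) (hc : HasCompactSupport f) :
    Integrable fun x => H (gradient f x) ^ N := by
  have hcont : Continuous (gradient f) :=
    (LinearIsometryEquiv.continuous _).comp (hf.continuous_fderiv one_ne_zero)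
  have hH : Continuous H := hnorm.1.locallyLipschitz.continuous
  refine ((hH.comp hcont).pow N).integrable_of_hasCompactSupport ?_
  refine (hc.fderiv ℝ).comp_left
    (g := fun L => H ((InnerProductSpace.toDual ℝ (Euc N)).symm L) ^ N) ?_
  rw [_root_.map_zero, hnorm.map_zero, zero_pow hN]

/-- Superposing `k` cutoff functions at decreasing scales costs at most `k` times the energy of
one of them, since their gradients have disjoint supports. -/
lemma exists_stacked_cutoff {N : ℕ} (hN : N ≠ 0) {H : Euc N → ℝ} (hnorm : IsFinslerNorm N H) :
    ∃ D : ℝ, 0 ≤ D ∧ ∀ (x₀ : Euc N) (R : ℝ), 0 < R → ∀ k : ℕ, ∃ s : ℝ, 0 < s ∧ s ≤ R ∧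
      ∃ f : Euc N → ℝ, ContDiff ℝ (⊤ : ℕ∞) f ∧ tsupport f ⊆ Metric.closedBall x₀ R ∧
      (∀ x ∈ Metric.ball x₀ s, f x = k) ∧ ∫ x, H (gradient f x) ^ N ≤ k * D := by
  obtain ⟨D, hD0, hD⟩ := exists_cutoff_energy_le hN hnorm
  refine ⟨D, hD0, fun x₀ R hR k => ?_⟩
  induction k with
  | zero =>
    refine ⟨R, hR, le_rfl, 0, contDiff_const, by simp, by simp, ?_⟩
    have : ∀ x, gradient (0 : Euc N → ℝ) x = 0 := fun x => by
      rw [gradient, fderiv_zero, Pi.zero_apply, _root_.map_zero]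
    simp [this, hnorm.map_zero, hN]
  | succ k ih =>
    obtain ⟨s, hs, hsR, f, hf, hfs, hfk, hfe⟩ := ih
    obtain ⟨η, hη, hηs, hη1, hηe⟩ := hD x₀ (s / 2) (by positivity)
    have hηR : tsupport η ⊆ Metric.closedBall x₀ R :=
      hηs.trans (Metric.closedBall_subset_closedBall (by linarith))
    have hfc : HasCompactSupport f :=
      (isCompact_closedBall x₀ R).of_isClosed_subset (isClosed_tsupport f) hfs
    have hηc : HasCompactSupport η :=
      (isCompact_closedBall x₀ R).of_isClosed_subset (isClosed_tsupport η) hηR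
    have hf1 : ContDiff ℝ 1 f := hf.of_le (by exact_mod_cast le_top)
    have hη1' : ContDiff ℝ 1 η := hη.of_le (by exact_mod_cast le_top)
    refine ⟨s / 2 / 2, by positivity, by linarith, f + η, hf.add hη,
      (tsupport_add f η).trans (union_subset hfs hηR), ?_, ?_⟩
    · intro x hx
      rw [Pi.add_apply, hη1 x hx, hfk x (Metric.ball_subset_ball (by linarith) hx)]
      push_cast
      ring
    · have hpt : ∀ x, H (gradient (f + η) x) ^ N ≤
          H (gradient f x) ^ N + H (gradient η x) ^ N := by
        intro x
        rw [gradient_add (hf1.differentiable one_ne_zero x) (hη1'.differentiable one_ne_zero x)]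
        by_cases hx : x ∈ Metric.ball x₀ s
        · have h0 : gradient f x = 0 := by
            have heq : f =ᶠ[𝓝 x] fun _ => (k : ℝ) := by
              filter_upwards [Metric.isOpen_ball.mem_nhds hx] with y hy using hfk y hy
            rw [gradient, heq.fderiv_eq, fderiv_const_apply, _root_.map_zero]
          rw [h0, zero_add, hnorm.map_zero, zero_pow hN, zero_add]
        · have h0 : gradient η x = 0 := by
            rw [gradient, image_eq_zero_of_notMem_tsupport (f := fderiv ℝ η) (fun h => hx ?_),
              _root_.map_zero]
            exact Metric.closedBall_subset_ball (by linarith) (hηs (tsupport_fderiv_subset ℝ h))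
          rw [h0, add_zero, hnorm.map_zero, zero_pow hN, add_zero]
      have hif := integrable_energy hN hnorm hf1 hfc
      have hiη := integrable_energy hN hnorm hη1' hηc
      calc _ ≤ ∫ x, (H (gradient f x) ^ N + H (gradient η x) ^ N) :=
            integral_mono (integrable_energy hN hnorm (hf1.add hη1') (hfc.add hηc))
              (hif.add hiη) hpt
        _ ≤ _ := by
            rw [integral_add hif hiη]
            push_cast
            linarith

/-- Points have zero `N`-capacity. -/
lemma exists_cutoff_small_energy {N : ℕ} (hN : 2 ≤ N) {H : Euc N → ℝ}
    (hnorm : IsFinslerNorm N H) {Ω : Set (Euc N)} (hΩ : IsOpen Ω) {x₀ : Euc N} (hx₀ : x₀ ∈ Ω)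
    {ε : ℝ} (hε : 0 < ε) :
    ∃ φ : Euc N → ℝ, ContDiff ℝ (⊤ : ℕ∞) φ ∧ HasCompactSupport φ ∧ tsupport φ ⊆ Ω ∧
      (∃ s > 0, Metric.ball x₀ s ⊆ Ω ∧ ∀ x ∈ Metric.ball x₀ s, φ x = 1) ∧
      ∫ x in Ω, H (gradient φ x) ^ N ≤ ε := by
  have hN0 : N ≠ 0 := by lia
  obtain ⟨R, hR, hRΩ⟩ := Metric.nhds_basis_closedBall.mem_iff.1 (hΩ.mem_nhds hx₀)
  obtain ⟨D, hD0, hD⟩ := exists_stacked_cutoff hN0 hnorm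
  obtain ⟨k, hk⟩ := exists_nat_gt (D / ε)
  have hk0 : (0 : ℝ) < k := lt_of_le_of_lt (by positivity) hk
  have hk1 : (1 : ℝ) ≤ k := by exact_mod_cast (Nat.cast_pos.1 hk0)
  obtain ⟨s, hs, hsR, f, hf, hfs, hfk, hfe⟩ := hD x₀ R hR k
  have hfc : HasCompactSupport f :=
    (isCompact_closedBall x₀ R).of_isClosed_subset (isClosed_tsupport f) hfs
  have hf1 : ContDiff ℝ 1 f := hf.of_le (by exact_mod_cast le_top)
  refine ⟨(k : ℝ)⁻¹ • f, hf.const_smul (k : ℝ)⁻¹, hfc.smul_left,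
    ((tsupport_smul_subset_right (fun _ => (k : ℝ)⁻¹) f).trans hfs).trans hRΩ,
    ⟨s, hs, (Metric.ball_subset_closedBall.trans
      (Metric.closedBall_subset_closedBall hsR)).trans hRΩ, ?_⟩, ?_⟩
  · intro x hx
    rw [Pi.smul_apply, hfk x hx, smul_eq_mul, inv_mul_cancel₀ hk0.ne']
  · have hgr : ∀ x, H (gradient ((k : ℝ)⁻¹ • f) x) ^ N =
        ((k : ℝ)⁻¹) ^ N * H (gradient f x) ^ N := fun x => by
      rw [gradient_const_smul (hf1.differentiable one_ne_zero x), hnorm.map_smul,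
        abs_of_pos (by positivity), mul_pow]
    simp only [hgr]
    rw [integral_const_mul]
    have h1 : ∫ x in Ω, H (gradient f x) ^ N ≤ k * D :=
      (setIntegral_le_integral (integrable_energy hN0 hnorm hf1 hfc)
        (Eventually.of_forall fun x => pow_nonneg (hnorm.nonneg _) _)).trans hfe
    have h2 : ((k : ℝ)⁻¹) ^ N ≤ ((k : ℝ)⁻¹) ^ 2 :=
      pow_le_pow_of_le_one (by positivity) (inv_le_one_of_one_le₀ hk1) hN
    calc _ ≤ ((k : ℝ)⁻¹) ^ 2 * (k * D) := by
          have h3 : 0 ≤ ∫ x in Ω, H (gradient f x) ^ N :=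
            integral_nonneg fun x => pow_nonneg (hnorm.nonneg _) _
          gcongr
      _ = D / k := by field_simp
      _ ≤ ε := by
        rw [div_le_iff₀ hk0]
        rw [div_lt_iff₀ hε] at hk
        linarith

lemma energyInf_nonneg {N : ℕ} {H : Euc N → ℝ} (hnorm : IsFinslerNorm N H) (Ω : Set (Euc N))
    (p : ℝ) : 0 ≤ energyInf N H Ω p := by
  refine Real.sInf_nonneg ?_
  rintro c ⟨u, -, -, -, -, rfl⟩
  exact integral_nonneg fun x => pow_nonneg (hnorm.nonneg _) _

/-- Bound for `energyInf` by the energy of a single function equal to `1` on a set. -/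
lemma energyInf_le_of_cutoff {N : ℕ} {H : Euc N → ℝ} (hnorm : IsFinslerNorm N H)
    {Ω : Set (Euc N)} {p : ℝ} (hp : 0 < p) {φ : Euc N → ℝ} (hφ : ContDiff ℝ (⊤ : ℕ∞) φ)
    (hφc : HasCompactSupport φ) (hφs : tsupport φ ⊆ Ω) {A : Set (Euc N)}
    (hA : MeasurableSet A) (hAΩ : A ⊆ Ω) (hφA : ∀ x ∈ A, φ x = 1) (hA0 : 0 < volume.real A) :
    energyInf N H Ω p ≤
      (volume.real A ^ (-(1 / (p + 1)))) ^ N * ∫ x in Ω, H (gradient φ x) ^ N := by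
  have hp1 : 0 < p + 1 := by linarith
  have hAfin : volume A ≠ ⊤ := fun h => by simp [Measure.real, h] at hA0
  set a := ∫ x in Ω, |φ x| ^ (p + 1) with ha
  have hint : Integrable fun x => |φ x| ^ (p + 1) := by
    refine (hφ.continuous.abs.rpow_const fun _ =>
      Or.inr hp1.le).integrable_of_hasCompactSupport ?_
    exact hφc.comp_left (g := fun t : ℝ => |t| ^ (p + 1)) (by simp [hp1.ne'])
  have hAa : volume.real A ≤ a := by
    calc volume.real A = ∫ x in A, (1 : ℝ) := by simp
      _ = ∫ x in A, |φ x| ^ (p + 1) :=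
          setIntegral_congr_fun hA fun x hx => by simp [hφA x hx]
      _ ≤ a := setIntegral_mono_set hint.integrableOn
          (Eventually.of_forall fun x => by positivity) hAΩ.eventuallyLE
  have ha0 : 0 < a := hA0.trans_le hAa
  set t := a ^ (-(1 / (p + 1))) with ht
  have ht0 : 0 < t := by positivity
  have hφ1 : ContDiff ℝ 1 φ := hφ.of_le (by exact_mod_cast le_top)
  have htp : t ^ (p + 1) * a = 1 := by
    rw [ht, ← Real.rpow_mul ha0.le, neg_mul, one_div_mul_cancel hp1.ne', Real.rpow_neg_one,
      inv_mul_cancel₀ ha0.ne']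
  have hle : energyInf N H Ω p ≤ t ^ N * ∫ x in Ω, H (gradient φ x) ^ N := by
    refine csInf_le ⟨0, ?_⟩ ⟨t • φ, hφ.const_smul t, hφc.smul_left,
      (tsupport_smul_subset_right (fun _ => t) φ).trans hφs, ?_, ?_⟩
    · rintro c ⟨u, -, -, -, -, rfl⟩
      exact integral_nonneg fun x => pow_nonneg (hnorm.nonneg _) _
    · simp only [Pi.smul_apply, smul_eq_mul, abs_mul, abs_of_pos ht0]
      simp only [Real.mul_rpow ht0.le (abs_nonneg _)]
      rw [integral_const_mul, htp]
    · rw [← integral_const_mul]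
      congr 1 with x
      rw [gradient_const_smul (hφ1.differentiable one_ne_zero x), hnorm.map_smul,
        abs_of_pos ht0, mul_pow]
  refine hle.trans ?_
  have h0 : 0 ≤ ∫ x in Ω, H (gradient φ x) ^ N :=
    integral_nonneg fun x => pow_nonneg (hnorm.nonneg _) _
  gcongr ?_ ^ N * _
  exact Real.rpow_le_rpow_of_nonpos hA0 hAa (by simp only [one_div, Left.neg_nonpos_iff]; positivity)

/-- The least energy `C_p` tends to zero as `p → ∞`. -/
lemma tendsto_energyInf {N : ℕ} (hN : 2 ≤ N) {H : Euc N → ℝ} (hnorm : IsFinslerNorm N H)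
    {Ω : Set (Euc N)} (hΩ : IsOpen Ω) (hne : Ω.Nonempty) :
    Tendsto (energyInf N H Ω) atTop (𝓝 0) := by
  obtain ⟨x₀, hx₀⟩ := hne
  refine tendsto_order.2 ⟨fun a ha =>
    Eventually.of_forall fun p => ha.trans_le (energyInf_nonneg hnorm Ω p), fun ε hε => ?_⟩
  obtain ⟨φ, hφ, hφc, hφs, ⟨s, hs, hsΩ, hφ1⟩, hφe⟩ :=
    exists_cutoff_small_energy hN hnorm hΩ hx₀ (half_pos hε)
  have hA0 : 0 < volume.real (Metric.ball x₀ s) :=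
    ENNReal.toReal_pos (Metric.measure_ball_pos volume x₀ hs).ne' measure_ball_lt_top.ne
  have hexp : Tendsto (fun p : ℝ => -(1 / (p + 1))) atTop (𝓝 0) := by
    have h1 : Tendsto (fun p : ℝ => 1 / (p + 1)) atTop (𝓝 0) := by
      simp only [one_div]
      exact tendsto_inv_atTop_zero.comp (tendsto_atTop_add_const_right _ _ tendsto_id)
    simpa using h1.neg
  have hlim : Tendsto (fun p : ℝ => (volume.real (Metric.ball x₀ s) ^ (-(1 / (p + 1)))) ^ N *
      ∫ x in Ω, H (gradient φ x) ^ N) atTop (𝓝 (∫ x in Ω, H (gradient φ x) ^ N)) := by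
    have h2 := ((tendsto_const_nhds (x := volume.real (Metric.ball x₀ s))).rpow hexp
      (Or.inl hA0.ne')).pow N
    simpa using h2.mul_const (∫ x in Ω, H (gradient φ x) ^ N)
  filter_upwards [hlim.eventually (Iio_mem_nhds (by linarith :
    (∫ x in Ω, H (gradient φ x) ^ N) < ε)), eventually_gt_atTop 0] with p h1 h2
  exact (energyInf_le_of_cutoff hnorm h2 hφ hφc hφs Metric.isOpen_ball.measurableSet hsΩ hφ1
    hA0).trans_lt h1

/-- The masses `∫ u ^ p` of least energy solutions tend to zero as `p → ∞`. -/
lemma tendsto_integral_rpow {N : ℕ} (hN : 2 ≤ N) {H : Euc N → ℝ}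
    (hnorm : IsFinslerNorm N H) (hreg : FinslerRegular N H)
    {Ω : Set (Euc N)} (hΩ : IsOpen Ω) (hb : Bornology.IsBounded Ω) (hne : Ω.Nonempty)
    {p : ℕ → ℝ} (hp : ∀ n, 1 < p n) (hptop : Tendsto p atTop atTop)
    {u : ℕ → Euc N → ℝ} (hu : ∀ n, IsLeastEnergySolution N H Ω (p n) (u n)) :
    Tendsto (fun n => ∫ x in Ω, u n x ^ p n) atTop (𝓝 0) := by
  have hC : Tendsto (fun n => energyInf N H Ω (p n)) atTop (𝓝 0) :=
    (tendsto_energyInf hN hnorm hΩ hne).comp hptop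
  have hF : ∀ᶠ n in atTop, ∫ x in Ω, u n x ^ (p n + 1) ≤ energyInf N H Ω (p n) := by
    filter_upwards [hC.eventually (Iio_mem_nhds one_pos), hptop.eventually_ge_atTop (N : ℝ)]
      with n h1 h2
    obtain ⟨hu1, hpos, hfr, hw, hen⟩ := hu n
    have hp1 : 0 < p n + 1 := by linarith [hp n]
    have hle := integral_rpow_add_one_le_energy hN hnorm hreg hΩ hb (by linarith [hp n]) hu1 hpos
      hfr hw
    rw [hen] at hle
    set F := ∫ x in Ω, u n x ^ (p n + 1)
    have hF0 : 0 ≤ F := setIntegral_nonneg hΩ.measurableSet fun x hx =>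
      Real.rpow_nonneg (hpos x hx).le _
    rcases hF0.eq_or_lt with h0 | h0
    · rw [← h0]; exact energyInf_nonneg hnorm Ω _
    set θ := (N : ℝ) / (p n + 1)
    have hθ0 : 0 ≤ θ := by positivity
    have hθ1 : θ ≤ 1 := (div_le_one hp1).2 (by linarith)
    have hFθ : F ^ (1 - θ) ≤ energyInf N H Ω (p n) := by
      rw [Real.rpow_sub h0, Real.rpow_one, div_le_iff₀ (by positivity)]
      exact hle
    rcases le_total F 1 with hF1 | hF1
    · refine le_trans ?_ hFθ
      calc F = F ^ (1 : ℝ) := (Real.rpow_one F).symm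
        _ ≤ F ^ (1 - θ) := Real.rpow_le_rpow_of_exponent_ge h0 hF1 (by linarith)
    · have := Real.one_le_rpow hF1 (by linarith : 0 ≤ 1 - θ)
      have h1' : energyInf N H Ω (p n) < 1 := h1
      linarith
  have hhalf : Tendsto (fun n => (1 / 2 : ℝ) ^ p n) atTop (𝓝 0) :=
    (tendsto_rpow_atTop_of_base_lt_one _ (by norm_num) (by norm_num)).comp hptop
  have hupper : Tendsto (fun n => (1 / 2 : ℝ) ^ p n * volume.real Ω +
      2 * energyInf N H Ω (p n)) atTop (𝓝 0) := by
    simpa using (hhalf.mul_const (volume.real Ω)).add (hC.const_mul 2)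
  refine squeeze_zero' (Eventually.of_forall fun n => ?_) ?_ hupper
  · exact setIntegral_nonneg hΩ.measurableSet fun x hx => Real.rpow_nonneg ((hu n).2.1 x hx).le _
  · filter_upwards [hF] with n hn
    have hp0 : 0 < p n := by linarith [hp n]
    have hcont := (hu n).1.continuousOn
    have hup : IntegrableOn (fun x => u n x ^ p n) Ω :=
      integrableOn_of_continuousOn_closure hb (hcont.rpow_const fun x _ => Or.inr hp0.le)
    have hup1 : IntegrableOn (fun x => u n x ^ (p n + 1)) Ω :=
      integrableOn_of_continuousOn_closure hb
        (hcont.rpow_const fun x _ => Or.inr (by linarith))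
    have hconst : IntegrableOn (fun _ : Euc N => (1 / 2 : ℝ) ^ p n) Ω :=
      integrableOn_const hb.measure_lt_top.ne
    calc ∫ x in Ω, u n x ^ p n
        ≤ ∫ x in Ω, ((1 / 2 : ℝ) ^ p n + 2 * u n x ^ (p n + 1)) := by
          refine setIntegral_mono_on hup (hconst.add (hup1.const_mul 2)) hΩ.measurableSet
            fun x hx => ?_
          have hx0 := (hu n).2.1 x hx
          have hx1 := Real.rpow_nonneg hx0.le (p n)
          rcases le_total (u n x) (1 / 2) with h | h
          · have := Real.rpow_le_rpow hx0.le h hp0.le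
            have := Real.rpow_nonneg hx0.le (p n + 1)
            linarith
          · rw [Real.rpow_add_one hx0.ne']
            have : 0 ≤ (1 / 2 : ℝ) ^ p n := by positivity
            nlinarith
      _ = (1 / 2 : ℝ) ^ p n * volume.real Ω + 2 * ∫ x in Ω, u n x ^ (p n + 1) := by
          rw [integral_add hconst (hup1.const_mul 2), integral_const_mul, setIntegral_const,
            smul_eq_mul, mul_comm]
      _ ≤ _ := by gcongr

lemma exists_isMaxOn_of_frontier_zero {N : ℕ} {Ω : Set (Euc N)} (hΩ : IsOpen Ω)
    (hb : Bornology.IsBounded Ω) (hne : Ω.Nonempty) {u : Euc N → ℝ}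
    (hu : ContinuousOn u (closure Ω)) (hpos : ∀ x ∈ Ω, 0 < u x)
    (hfr : ∀ x ∈ frontier Ω, u x = 0) : ∃ x ∈ Ω, ∀ y ∈ Ω, u y ≤ u x := by
  obtain ⟨x, hx, hmax⟩ := hb.isCompact_closure.exists_isMaxOn hne.closure hu
  obtain ⟨z, hz⟩ := hne
  have hzx : u z ≤ u x := hmax (subset_closure hz)
  refine ⟨x, ?_, fun y hy => hmax (subset_closure hy)⟩
  by_contra hxΩ
  have h0 := hfr x ⟨hx, by rwa [hΩ.interior_eq]⟩
  linarith [hpos z hz]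

/-- Elementary dichotomy: if `I ≤ M ^ p * V` and `I → 0` with `p → ∞`, then `M / I ^ q → ∞`. -/
lemma tendsto_div_rpow_atTop {p M I : ℕ → ℝ} {V q : ℝ} (hq : 0 < q) (hV : 0 < V)
    (hptop : Tendsto p atTop atTop) (hM : ∀ n, 0 < M n) (hI : ∀ n, 0 < I n)
    (hIM : ∀ n, I n ≤ M n ^ p n * V) (hI0 : Tendsto I atTop (𝓝 0)) :
    Tendsto (fun n => M n / I n ^ q) atTop atTop := by
  have hIq : Tendsto (fun n => I n ^ q) atTop (𝓝[>] 0) := by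
    refine tendsto_nhdsWithin_iff.2 ⟨?_, Eventually.of_forall fun n => Real.rpow_pos_of_pos (hI n) q⟩
    simpa [hq.ne'] using hI0.rpow_const (p := q) (Or.inr hq.le)
  have hA : Tendsto (fun n => (1 / 2 : ℝ) * (I n ^ q)⁻¹) atTop atTop :=
    hIq.inv_tendsto_nhdsGT_zero.const_mul_atTop (by norm_num)
  have hpq : Tendsto (fun n => p n * q - 1) atTop atTop :=
    tendsto_atTop_add_const_right _ _ (hptop.atTop_mul_const hq)
  have hB : Tendsto (fun n => (V ^ q)⁻¹ * (2 : ℝ) ^ (p n * q - 1)) atTop atTop :=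
    ((tendsto_rpow_atTop_of_base_gt_one 2 (by norm_num)).comp hpq).const_mul_atTop
      (by positivity)
  refine tendsto_atTop.2 fun K => ?_
  filter_upwards [hA.eventually_ge_atTop K, hB.eventually_ge_atTop K, hpq.eventually_ge_atTop 0]
    with n h1 h2 h3
  have hMn := hM n
  have hIn := Real.rpow_pos_of_pos (hI n) q
  rcases le_total (1 / 2) (M n) with h | h
  · refine h1.trans ?_
    rw [div_eq_mul_inv (M n)]
    gcongr
  · refine h2.trans ?_
    have hle : I n ^ q ≤ M n ^ (p n * q) * V ^ q := by
      calc I n ^ q ≤ (M n ^ p n * V) ^ q := Real.rpow_le_rpow (hI n).le (hIM n) hq.le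
        _ = _ := by rw [Real.mul_rpow (by positivity) hV.le, ← Real.rpow_mul hMn.le]
    have h2M : (2 : ℝ) ≤ (M n)⁻¹ := by
      rw [le_inv_comm₀ (by norm_num) hMn]
      linarith
    calc (V ^ q)⁻¹ * (2 : ℝ) ^ (p n * q - 1)
        ≤ (V ^ q)⁻¹ * (M n)⁻¹ ^ (p n * q - 1) := by gcongr
      _ = M n / (M n ^ (p n * q) * V ^ q) := by
          rw [Real.inv_rpow hMn.le, Real.rpow_sub hMn, Real.rpow_one]
          field_simp
      _ ≤ M n / I n ^ q := by gcongr

/-- The blow-up set is non-empty (Theorem 1.3, first assertion). -/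
theorem blowup_set_nonempty (N : ℕ) (hN : 2 ≤ N) (H : Euc N → ℝ)
    (hnorm : IsFinslerNorm N H) (hreg : FinslerRegular N H)
    (Ω : Set (Euc N)) (hΩo : IsOpen Ω) (hΩb : Bornology.IsBounded Ω) (hΩne : Ω.Nonempty)
    (p : ℕ → ℝ) (hp : ∀ n, 1 < p n) (hptop : Tendsto p atTop atTop)
    (u : ℕ → Euc N → ℝ) (hu : ∀ n, IsLeastEnergySolution N H Ω (p n) (u n))
    (v : ℕ → Euc N → ℝ)
    (hv : ∀ n x, v n x = u n x / (∫ y in Ω, u n y ^ p n) ^ (1 / ((N : ℝ) - 1))) :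
    (BlowUpSet Ω v).Nonempty := by
  have hmax := fun n => exists_isMaxOn_of_frontier_zero hΩo hΩb hΩne (hu n).1.continuousOn
    (hu n).2.1 (hu n).2.2.1
  choose xs hxs hxmax using hmax
  have hN' : (2 : ℝ) ≤ N := by exact_mod_cast hN
  have hV : 0 < volume.real Ω :=
    ENNReal.toReal_pos (hΩo.measure_pos volume hΩne).ne' hΩb.measure_lt_top.ne
  have hup : ∀ n, IntegrableOn (fun x => u n x ^ p n) Ω := fun n =>
    integrableOn_of_continuousOn_closure hΩb
      ((hu n).1.continuousOn.rpow_const fun x _ => Or.inr (by linarith [hp n]))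
  have hI : ∀ n, 0 < ∫ y in Ω, u n y ^ p n := by
    intro n
    rw [setIntegral_pos_iff_support_of_nonneg_ae _ (hup n)]
    · refine (hΩo.measure_pos volume hΩne).trans_le (measure_mono fun x hx => ⟨?_, hx⟩)
      exact (Real.rpow_pos_of_pos ((hu n).2.1 x hx) _).ne'
    · filter_upwards [ae_restrict_mem hΩo.measurableSet] with x hx
      exact Real.rpow_nonneg ((hu n).2.1 x hx).le _
  have hIM : ∀ n, ∫ y in Ω, u n y ^ p n ≤ u n (xs n) ^ p n * volume.real Ω := by
    intro n
    calc ∫ y in Ω, u n y ^ p n ≤ ∫ _ in Ω, u n (xs n) ^ p n :=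
          setIntegral_mono_on (hup n) (integrableOn_const hΩb.measure_lt_top.ne)
            hΩo.measurableSet fun x hx => Real.rpow_le_rpow ((hu n).2.1 x hx).le
              (hxmax n x hx) (by linarith [hp n])
      _ = _ := by rw [setIntegral_const, smul_eq_mul, mul_comm]
  have hlim : Tendsto (fun n => v n (xs n)) atTop atTop := by
    simp only [hv]
    exact tendsto_div_rpow_atTop (one_div_pos.2 (by linarith)) hV hptop
      (fun n => (hu n).2.1 _ (hxs n)) hI hIM
      (tendsto_integral_rpow hN hnorm hreg hΩo hΩb hΩne hp hptop hu)
  obtain ⟨x, hx, σ, hσ, hσx⟩ :=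
    hΩb.isCompact_closure.tendsto_subseq fun n => subset_closure (hxs n)
  exact ⟨x, hx, σ, hσ, fun n => xs (σ n), fun n => hxs _, hσx, hlim.comp hσ.tendsto_atTop⟩
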